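/- arXiv:2510.09992 — 2 statements merged into one kernel-verified Lean document; each statement's English description precedes it below -/
import Mathlib

section
/- Let η : ℝ² → ℝ be smooth with η(x) > 0 for all x, define q₀, w₁, w₂, w₃ as in the context, and set q(x,z) = q₀(x) + ∂₃w₃(x,z). Let A(w) be the 3×3 matrix field with rows (∂₁w₁, ∂₂w₁, −∂₁w₃), (∂₁w₂, ∂₂w₂, −∂₂w₃), (∂₁w₃, ∂₂w₃, 0). Then for all (x,z) ∈ ℝ² × ℝ and each i ∈ {1,2,3}: Δw_i(x,z) − ∂_i q(x,z) = ∑_{j=1}^{3} ∂_j (A(w))_{ij}(x,z), where Δ = ∂₁₁ + ∂₂₂ + ∂₃₃ is the full three-dimensional Laplacian, ∂₁,∂₂ are derivatives in the horizontal variables and ∂₃ in the vertical variable z. -/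
noncomputable section

/-- Partial derivative of `f : ℝ² → ℝ` in the first horizontal variable. -/
def pdx1 (f : ℝ × ℝ → ℝ) (x : ℝ × ℝ) : ℝ := deriv (fun s => f (s, x.2)) x.1

/-- Partial derivative of `f : ℝ² → ℝ` in the second horizontal variable. -/
def pdx2 (f : ℝ × ℝ → ℝ) (x : ℝ × ℝ) : ℝ := deriv (fun s => f (x.1, s)) x.2

/-- Horizontal Laplacian of `f : ℝ² → ℝ`. -/
def lapx (f : ℝ × ℝ → ℝ) (x : ℝ × ℝ) : ℝ := pdx1 (pdx1 f) x + pdx2 (pdx2 f) x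

/-- The pressure-like quantity `q₀ = −6/η²`. -/
def q0 (η : ℝ × ℝ → ℝ) (x : ℝ × ℝ) : ℝ := -6 / (η x) ^ 2

/-- First component of the test function: `w₁(x,z) = ½ z (z − η(x)) ∂₁q₀(x)`. -/
def w1 (η : ℝ × ℝ → ℝ) (x : ℝ × ℝ) (z : ℝ) : ℝ :=
  (1 / 2) * z * (z - η x) * pdx1 (q0 η) x

/-- Second component of the test function: `w₂(x,z) = ½ z (z − η(x)) ∂₂q₀(x)`. -/
def w2 (η : ℝ × ℝ → ℝ) (x : ℝ × ℝ) (z : ℝ) : ℝ :=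
  (1 / 2) * z * (z - η x) * pdx2 (q0 η) x

/-- Third component of the test function:
`w₃(x,z) = (1/12) z² (3η − 2z) Δ_x q₀ + ¼ z² ∇_xη·∇_x q₀`. -/
def w3 (η : ℝ × ℝ → ℝ) (x : ℝ × ℝ) (z : ℝ) : ℝ :=
  (1 / 12) * z ^ 2 * (3 * η x - 2 * z) * lapx (q0 η) x
    + (1 / 4) * z ^ 2 * (pdx1 η x * pdx1 (q0 η) x + pdx2 η x * pdx2 (q0 η) x)

/-- Partial derivative in the first horizontal variable of a function of `(x,z) ∈ ℝ² × ℝ`. -/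
def pd1 (f : ℝ × ℝ → ℝ → ℝ) (x : ℝ × ℝ) (z : ℝ) : ℝ := deriv (fun s => f (s, x.2) z) x.1

/-- Partial derivative in the second horizontal variable of a function of `(x,z) ∈ ℝ² × ℝ`. -/
def pd2 (f : ℝ × ℝ → ℝ → ℝ) (x : ℝ × ℝ) (z : ℝ) : ℝ := deriv (fun s => f (x.1, s) z) x.2

/-- Partial derivative in the vertical variable `z` of a function of `(x,z) ∈ ℝ² × ℝ`. -/
def pd3 (f : ℝ × ℝ → ℝ → ℝ) (x : ℝ × ℝ) (z : ℝ) : ℝ := deriv (f x) z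

end

/-- The pressure `q(x,z) = q₀(x) + ∂₃w₃(x,z)`. -/
noncomputable def qq (η : ℝ × ℝ → ℝ) (x : ℝ × ℝ) (z : ℝ) : ℝ := q0 η x + pd3 (w3 η) x z

/-- The full three-dimensional Laplacian of a function of `(x,z) ∈ ℝ² × ℝ`. -/
noncomputable def lap3 (f : ℝ × ℝ → ℝ → ℝ) (x : ℝ × ℝ) (z : ℝ) : ℝ :=
  pd1 (pd1 f) x z + pd2 (pd2 f) x z + pd3 (pd3 f) x z

theorem hasDerivAt_pdx1 {f : ℝ × ℝ → ℝ} (hf : Differentiable ℝ f) (x : ℝ × ℝ) :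
    HasDerivAt (fun s => f (s, x.2)) (pdx1 f x) x.1 := by
  have h : Differentiable ℝ fun s : ℝ => f (s, x.2) := by fun_prop
  exact (h x.1).hasDerivAt

theorem hasDerivAt_pdx2 {f : ℝ × ℝ → ℝ} (hf : Differentiable ℝ f) (x : ℝ × ℝ) :
    HasDerivAt (fun s => f (x.1, s)) (pdx2 f x) x.2 := by
  have h : Differentiable ℝ fun s : ℝ => f (x.1, s) := by fun_prop
  exact (h x.2).hasDerivAt

theorem pdx1_eq_fderiv {f : ℝ × ℝ → ℝ} (hf : Differentiable ℝ f) :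
    pdx1 f = fun x => fderiv ℝ f x (1, 0) := by
  funext x
  exact ((hf x).hasFDerivAt.comp_hasDerivAt x.1
    ((hasDerivAt_id x.1).prodMk (hasDerivAt_const x.1 x.2))).deriv

theorem pdx2_eq_fderiv {f : ℝ × ℝ → ℝ} (hf : Differentiable ℝ f) :
    pdx2 f = fun x => fderiv ℝ f x (0, 1) := by
  funext x
  exact ((hf x).hasFDerivAt.comp_hasDerivAt x.2
    ((hasDerivAt_const x.2 x.1).prodMk (hasDerivAt_id x.2))).deriv

theorem contDiff_pdx1 {f : ℝ × ℝ → ℝ} (hf : ContDiff ℝ (⊤ : ℕ∞) f) :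
    ContDiff ℝ (⊤ : ℕ∞) (pdx1 f) := by
  rw [pdx1_eq_fderiv (hf.differentiable (by simp))]
  exact (hf.fderiv_right (by simp)).clm_apply contDiff_const

theorem contDiff_pdx2 {f : ℝ × ℝ → ℝ} (hf : ContDiff ℝ (⊤ : ℕ∞) f) :
    ContDiff ℝ (⊤ : ℕ∞) (pdx2 f) := by
  rw [pdx2_eq_fderiv (hf.differentiable (by simp))]
  exact (hf.fderiv_right (by simp)).clm_apply contDiff_const

theorem contDiff_lapx {f : ℝ × ℝ → ℝ} (hf : ContDiff ℝ (⊤ : ℕ∞) f) :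
    ContDiff ℝ (⊤ : ℕ∞) (lapx f) :=
  (contDiff_pdx1 (contDiff_pdx1 hf)).add (contDiff_pdx2 (contDiff_pdx2 hf))

theorem contDiff_q0 {η : ℝ × ℝ → ℝ} (hη : ContDiff ℝ (⊤ : ℕ∞) η) (hpos : ∀ x, 0 < η x) :
    ContDiff ℝ (⊤ : ℕ∞) (q0 η) :=
  contDiff_const.div (hη.pow 2) fun x => (pow_pos (hpos x) 2).ne'

theorem hasDerivAt_sq_mul_add_cube_mul (a b z : ℝ) :
    HasDerivAt (fun s => s ^ 2 * a + s ^ 3 * b) (2 * z * a + 3 * z ^ 2 * b) z := by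
  have h := ((hasDerivAt_pow 2 z).mul_const a).add ((hasDerivAt_pow 3 z).mul_const b)
  exact h.congr_deriv (by norm_num)

/-- `w₃` is a cubic polynomial in `z` whose coefficients are smooth in `x`. -/
theorem exists_w3_eq {η : ℝ × ℝ → ℝ} (hη : ContDiff ℝ (⊤ : ℕ∞) η) (hpos : ∀ x, 0 < η x) :
    ∃ a b : ℝ × ℝ → ℝ, Differentiable ℝ a ∧ Differentiable ℝ b ∧
      w3 η = fun x z => z ^ 2 * a x + z ^ 3 * b x := by
  have hq := contDiff_q0 hη hpos
  have dη : Differentiable ℝ η := hη.differentiable (by simp)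
  have dη1 : Differentiable ℝ (pdx1 η) := (contDiff_pdx1 hη).differentiable (by simp)
  have dη2 : Differentiable ℝ (pdx2 η) := (contDiff_pdx2 hη).differentiable (by simp)
  have dq1 : Differentiable ℝ (pdx1 (q0 η)) := (contDiff_pdx1 hq).differentiable (by simp)
  have dq2 : Differentiable ℝ (pdx2 (q0 η)) := (contDiff_pdx2 hq).differentiable (by simp)
  have dl : Differentiable ℝ (lapx (q0 η)) := (contDiff_lapx hq).differentiable (by simp)
  refine ⟨fun x => (1 / 4) * (η x * lapx (q0 η) x
      + (pdx1 η x * pdx1 (q0 η) x + pdx2 η x * pdx2 (q0 η) x)),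
    fun x => -(1 / 6) * lapx (q0 η) x, by fun_prop, by fun_prop, ?_⟩
  funext x z
  simp only [w3]
  ring

theorem pd3_sq_mul_add_cube_mul (a b : ℝ × ℝ → ℝ) :
    pd3 (fun x z => z ^ 2 * a x + z ^ 3 * b x) =
      fun x z => 2 * z * a x + 3 * z ^ 2 * b x := by
  funext x z
  exact (hasDerivAt_sq_mul_add_cube_mul (a x) (b x) z).deriv

theorem pd3_neg_pd1_w3 {η : ℝ × ℝ → ℝ} (hη : ContDiff ℝ (⊤ : ℕ∞) η) (hpos : ∀ x, 0 < η x)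
    (x : ℝ × ℝ) (z : ℝ) :
    pd3 (fun x z => -(pd1 (w3 η) x z)) x z = pdx1 (q0 η) x - pd1 (qq η) x z := by
  obtain ⟨a, b, ha, hb, hw⟩ := exists_w3_eq hη hpos
  have hq := hasDerivAt_pdx1 ((contDiff_q0 hη hpos).differentiable (by simp)) x
  have ha := hasDerivAt_pdx1 ha
  have hb := hasDerivAt_pdx1 hb
  have h1 : pd1 (w3 η) = fun x z => z ^ 2 * pdx1 a x + z ^ 3 * pdx1 b x := by
    funext y t
    rw [hw]
    exact (((ha y).const_mul (t ^ 2)).add ((hb y).const_mul (t ^ 3))).deriv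
  have h2 : pd1 (qq η) x z = pdx1 (q0 η) x + (2 * z * pdx1 a x + 3 * z ^ 2 * pdx1 b x) := by
    simp only [pd1, qq, hw, pd3_sq_mul_add_cube_mul]
    exact (hq.add (((ha x).const_mul (2 * z)).add ((hb x).const_mul (3 * z ^ 2)))).deriv
  rw [h1, h2]
  exact (hasDerivAt_sq_mul_add_cube_mul (pdx1 a x) (pdx1 b x) z).neg.deriv.trans (by ring)

theorem pd3_neg_pd2_w3 {η : ℝ × ℝ → ℝ} (hη : ContDiff ℝ (⊤ : ℕ∞) η) (hpos : ∀ x, 0 < η x)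
    (x : ℝ × ℝ) (z : ℝ) :
    pd3 (fun x z => -(pd2 (w3 η) x z)) x z = pdx2 (q0 η) x - pd2 (qq η) x z := by
  obtain ⟨a, b, ha, hb, hw⟩ := exists_w3_eq hη hpos
  have hq := hasDerivAt_pdx2 ((contDiff_q0 hη hpos).differentiable (by simp)) x
  have ha := hasDerivAt_pdx2 ha
  have hb := hasDerivAt_pdx2 hb
  have h1 : pd2 (w3 η) = fun x z => z ^ 2 * pdx2 a x + z ^ 3 * pdx2 b x := by
    funext y t
    rw [hw]
    exact (((ha y).const_mul (t ^ 2)).add ((hb y).const_mul (t ^ 3))).deriv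
  have h2 : pd2 (qq η) x z = pdx2 (q0 η) x + (2 * z * pdx2 a x + 3 * z ^ 2 * pdx2 b x) := by
    simp only [pd2, qq, hw, pd3_sq_mul_add_cube_mul]
    exact (hq.add (((ha x).const_mul (2 * z)).add ((hb x).const_mul (3 * z ^ 2)))).deriv
  rw [h1, h2]
  exact (hasDerivAt_sq_mul_add_cube_mul (pdx2 a x) (pdx2 b x) z).neg.deriv.trans (by ring)

theorem deriv_deriv_half_mul_sub (e c z : ℝ) :
    deriv (deriv fun s => (1 / 2) * s * (s - e) * c) z = c := by
  have h : (deriv fun s : ℝ => (1 / 2) * s * (s - e) * c) = fun s => (s - e / 2) * c := by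
    funext t
    have h := ((((hasDerivAt_id t).const_mul (1 / 2)).mul
      ((hasDerivAt_id t).sub_const e)).mul_const c).deriv
    exact h.trans (by simp only [id]; ring)
  rw [h]
  exact ((((hasDerivAt_id z).sub_const (e / 2)).mul_const c).deriv).trans (one_mul c)

/-- With `q = q₀ + ∂₃w₃` and `A(w)` the matrix with rows `(∂₁w₁, ∂₂w₁, −∂₁w₃)`,
`(∂₁w₂, ∂₂w₂, −∂₂w₃)`, `(∂₁w₃, ∂₂w₃, 0)`, one has `Δw_i − ∂_i q = ∑_j ∂_j (A(w))_{ij}`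
for `i = 1,2,3`. -/
theorem w_laplacian_minus_pressure (η : ℝ × ℝ → ℝ) (hη : ContDiff ℝ (⊤ : ℕ∞) η)
    (hpos : ∀ x, 0 < η x) :
    ∀ (x : ℝ × ℝ) (z : ℝ),
      lap3 (w1 η) x z - pd1 (qq η) x z =
        pd1 (pd1 (w1 η)) x z + pd2 (pd2 (w1 η)) x z
          + pd3 (fun x z => -(pd1 (w3 η) x z)) x z ∧
      lap3 (w2 η) x z - pd2 (qq η) x z =
        pd1 (pd1 (w2 η)) x z + pd2 (pd2 (w2 η)) x z
          + pd3 (fun x z => -(pd2 (w3 η) x z)) x z ∧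
      lap3 (w3 η) x z - pd3 (qq η) x z =
        pd1 (pd1 (w3 η)) x z + pd2 (pd2 (w3 η)) x z
          + pd3 (fun _ _ => (0 : ℝ)) x z := by
  intro x z
  have e1 : pd3 (pd3 (w1 η)) x z = pdx1 (q0 η) x := deriv_deriv_half_mul_sub _ _ z
  have e2 : pd3 (pd3 (w2 η)) x z = pdx2 (q0 η) x := deriv_deriv_half_mul_sub _ _ z
  have e3 : pd3 (qq η) x z = pd3 (pd3 (w3 η)) x z := deriv_const_add _
  have e4 : pd3 (fun _ _ => (0 : ℝ)) x z = 0 := deriv_const z 0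
  refine ⟨?_, ?_, ?_⟩
  · rw [pd3_neg_pd1_w3 hη hpos, lap3, e1]
    ring
  · rw [pd3_neg_pd2_w3 hη hpos, lap3, e2]
    ring
  · rw [e3, e4, lap3]
    ring
end

section
/- There exists a constant C > 0 such that the following holds. Let η : ℝ² → ℝ be smooth with η(x) > 0 for all x, and define q₀, w₁, w₂, w₃ as in the context. Then for every x ∈ ℝ² and all indices α, j ∈ {1,2}: ∫₀^{η(x)} (∂_j w_α(x,z))² dz ≤ C·( ‖∇²_x η(x)‖²/η(x) + |∇_x η(x)|⁴/η(x)³ ), where ∇²_x η denotes the Hessian of η in the horizontal variables and ‖·‖ its Hilbert–Schmidt norm. -/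
/-- Squared Hilbert–Schmidt norm of the horizontal Hessian of `η`. -/
noncomputable def hessSq (η : ℝ × ℝ → ℝ) (x : ℝ × ℝ) : ℝ :=
  (pdx1 (pdx1 η) x) ^ 2 + (pdx2 (pdx1 η) x) ^ 2
    + (pdx1 (pdx2 η) x) ^ 2 + (pdx2 (pdx2 η) x) ^ 2

/-- Squared Euclidean norm of the horizontal gradient of `η`. -/
noncomputable def gradSq (η : ℝ × ℝ → ℝ) (x : ℝ × ℝ) : ℝ :=
  (pdx1 η x) ^ 2 + (pdx2 η x) ^ 2

theorem differentiable_pdx1 {f : ℝ × ℝ → ℝ} (hf : ContDiff ℝ 2 f) :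
    Differentiable ℝ (pdx1 f) := by
  have hd : Differentiable ℝ f := hf.differentiable (by norm_num)
  have h : pdx1 f = fun x => fderiv ℝ f x (1, 0) := by
    funext x
    exact ((hd x).hasFDerivAt.comp_hasDerivAt x.1
      ((hasDerivAt_id x.1).prodMk (hasDerivAt_const x.1 x.2))).deriv
  have h1 : Differentiable ℝ (fderiv ℝ f) :=
    (hf.fderiv_right (m := 1) (by norm_num)).differentiable (by norm_num)
  rw [h]
  fun_prop

theorem differentiable_pdx2 {f : ℝ × ℝ → ℝ} (hf : ContDiff ℝ 2 f) :
    Differentiable ℝ (pdx2 f) := by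
  have hd : Differentiable ℝ f := hf.differentiable (by norm_num)
  have h : pdx2 f = fun x => fderiv ℝ f x (0, 1) := by
    funext x
    exact ((hd x).hasFDerivAt.comp_hasDerivAt x.2
      ((hasDerivAt_const x.2 x.1).prodMk (hasDerivAt_id x.2))).deriv
  have h1 : Differentiable ℝ (fderiv ℝ f) :=
    (hf.fderiv_right (m := 1) (by norm_num)).differentiable (by norm_num)
  rw [h]
  fun_prop

theorem hasDerivAt_neg_six_div_sq {e : ℝ → ℝ} {e' t : ℝ} (he : HasDerivAt e e' t)
    (hpos : 0 < e t) : HasDerivAt (fun s => -6 / e s ^ 2) (12 * e' / e t ^ 3) t := by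
  have hne := hpos.ne'
  refine ((hasDerivAt_const t (-6 : ℝ)).fun_div (he.fun_pow 2) (pow_ne_zero 2 hne)).congr_deriv
    ?_
  field_simp
  ring

theorem pdx1_q0 {η : ℝ × ℝ → ℝ} (hη : Differentiable ℝ η) (hpos : ∀ x, 0 < η x) (x : ℝ × ℝ) :
    pdx1 (q0 η) x = 12 * pdx1 η x / η x ^ 3 :=
  (hasDerivAt_neg_six_div_sq (hasDerivAt_pdx1 hη x) (hpos x)).deriv

theorem pdx2_q0 {η : ℝ × ℝ → ℝ} (hη : Differentiable ℝ η) (hpos : ∀ x, 0 < η x) (x : ℝ × ℝ) :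
    pdx2 (q0 η) x = 12 * pdx2 η x / η x ^ 3 :=
  (hasDerivAt_neg_six_div_sq (hasDerivAt_pdx2 hη x) (hpos x)).deriv

/-- Derivative of the profile `½ z (z − e) · 12 g / e³` along a line. -/
theorem hasDerivAt_profile {e g : ℝ → ℝ} {e' g' t : ℝ} (he : HasDerivAt e e' t)
    (hg : HasDerivAt g g' t) (hpos : 0 < e t) (z : ℝ) :
    HasDerivAt (fun s => (1 / 2) * z * (z - e s) * (12 * g s / e s ^ 3))
      (6 * (z / e t) * ((z / e t - 1) * (g' / e t)
        + (2 - 3 * (z / e t)) * (g t * e' / e t ^ 2))) t := by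
  have hne := hpos.ne'
  refine (((he.const_sub z).const_mul ((1 / 2) * z)).fun_mul
    ((hg.const_mul 12).fun_div (he.fun_pow 3) (pow_ne_zero 3 hne))).congr_deriv ?_
  field_simp
  ring

theorem sq_profile_deriv_le {u : ℝ} (h0 : 0 ≤ u) (h1 : u ≤ 1) (a b : ℝ) :
    (6 * u * ((u - 1) * a + (2 - 3 * u) * b)) ^ 2 ≤ 288 * (a ^ 2 + b ^ 2) := by
  have hu : u ^ 2 ≤ 1 := by nlinarith
  have ha : ((u - 1) * a) ^ 2 ≤ 4 * a ^ 2 := by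
    rw [mul_pow]
    gcongr
    nlinarith
  have hb : ((2 - 3 * u) * b) ^ 2 ≤ 4 * b ^ 2 := by
    rw [mul_pow]
    gcongr
    nlinarith
  have hab : ((u - 1) * a + (2 - 3 * u) * b) ^ 2 ≤ 8 * (a ^ 2 + b ^ 2) := by
    nlinarith [sq_nonneg ((u - 1) * a - (2 - 3 * u) * b)]
  calc (6 * u * ((u - 1) * a + (2 - 3 * u) * b)) ^ 2
      = 36 * (u ^ 2 * ((u - 1) * a + (2 - 3 * u) * b) ^ 2) := by ring
    _ ≤ 36 * (1 * (8 * (a ^ 2 + b ^ 2))) := by gcongr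
    _ = 288 * (a ^ 2 + b ^ 2) := by ring

theorem integral_sq_deriv_profile_le {e g : ℝ → ℝ} {e' g' t H G : ℝ} (he : HasDerivAt e e' t)
    (hg : HasDerivAt g g' t) (hpos : 0 < e t) (hH : g' ^ 2 ≤ H) (hG : (g t * e') ^ 2 ≤ G) :
    ∫ z in Set.Ioo (0 : ℝ) (e t),
        (deriv (fun s => (1 / 2) * z * (z - e s) * (12 * g s / e s ^ 3)) t) ^ 2
      ≤ 288 * (H / e t + G / e t ^ 3) := by
  have hb : ∀ z ∈ Set.Ioo (0 : ℝ) (e t),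
      ‖(deriv (fun s => (1 / 2) * z * (z - e s) * (12 * g s / e s ^ 3)) t) ^ 2‖
        ≤ 288 * ((g' / e t) ^ 2 + (g t * e' / e t ^ 2) ^ 2) := by
    intro z hz
    rw [(hasDerivAt_profile he hg hpos z).deriv, Real.norm_of_nonneg (sq_nonneg _)]
    exact sq_profile_deriv_le (div_nonneg hz.1.le hpos.le) ((div_le_one hpos).2 hz.2.le) _ _
  have hint := MeasureTheory.norm_setIntegral_le_of_norm_le_const
    (μ := MeasureTheory.volume) (by simp) hb
  rw [Real.volume_real_Ioo_of_le hpos.le, sub_zero] at hint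
  calc _ ≤ _ := (Real.le_norm_self _).trans hint
    _ = 288 * (g' ^ 2 / e t + (g t * e') ^ 2 / e t ^ 3) := by field_simp
    _ ≤ 288 * (H / e t + G / e t ^ 3) := by gcongr

/-- There is a universal constant `C > 0` such that for every smooth positive `η`, every `x`, and
all horizontal indices `α, j ∈ {1,2}`,
`∫₀^{η(x)} (∂_j w_α)² dz ≤ C·(‖∇²_xη‖²/η + |∇_xη|⁴/η³)`. -/
theorem w_horizontal_gradient_bound : ∃ C : ℝ, 0 < C ∧
    ∀ (η : ℝ × ℝ → ℝ), ContDiff ℝ (⊤ : ℕ∞) η → (∀ x, 0 < η x) →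
      ∀ x : ℝ × ℝ,
        (∫ z in Set.Ioo (0 : ℝ) (η x), (pd1 (w1 η) x z) ^ 2 ≤
          C * (hessSq η x / η x + (gradSq η x) ^ 2 / (η x) ^ 3)) ∧
        (∫ z in Set.Ioo (0 : ℝ) (η x), (pd2 (w1 η) x z) ^ 2 ≤
          C * (hessSq η x / η x + (gradSq η x) ^ 2 / (η x) ^ 3)) ∧
        (∫ z in Set.Ioo (0 : ℝ) (η x), (pd1 (w2 η) x z) ^ 2 ≤
          C * (hessSq η x / η x + (gradSq η x) ^ 2 / (η x) ^ 3)) ∧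
        (∫ z in Set.Ioo (0 : ℝ) (η x), (pd2 (w2 η) x z) ^ 2 ≤
          C * (hessSq η x / η x + (gradSq η x) ^ 2 / (η x) ^ 3)) := by
  refine ⟨288, by norm_num, fun η hη hpos x => ?_⟩
  have h2 : ContDiff ℝ 2 η := contDiff_infty.1 hη 2
  have hd : Differentiable ℝ η := h2.differentiable (by norm_num)
  have hd1 := differentiable_pdx1 h2
  have hd2 := differentiable_pdx2 h2
  have hw1 : w1 η = fun x z => (1 / 2) * z * (z - η x) * (12 * pdx1 η x / η x ^ 3) := by
    funext x z
    rw [w1, pdx1_q0 hd hpos]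
  have hw2 : w2 η = fun x z => (1 / 2) * z * (z - η x) * (12 * pdx2 η x / η x ^ 3) := by
    funext x z
    rw [w2, pdx2_q0 hd hpos]
  rw [hw1, hw2]
  have hG11 : (pdx1 η x * pdx1 η x) ^ 2 ≤ gradSq η x ^ 2 := by
    unfold gradSq
    refine pow_le_pow_left₀ (mul_self_nonneg _) ?_ 2
    nlinarith [sq_nonneg (pdx2 η x)]
  have hG22 : (pdx2 η x * pdx2 η x) ^ 2 ≤ gradSq η x ^ 2 := by
    unfold gradSq
    refine pow_le_pow_left₀ (mul_self_nonneg _) ?_ 2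
    nlinarith [sq_nonneg (pdx1 η x)]
  have hG12 : (pdx1 η x * pdx2 η x) ^ 2 ≤ gradSq η x ^ 2 := by
    unfold gradSq
    nlinarith [sq_nonneg (pdx1 η x ^ 2), sq_nonneg (pdx2 η x ^ 2),
      sq_nonneg (pdx1 η x * pdx2 η x)]
  have hG21 : (pdx2 η x * pdx1 η x) ^ 2 ≤ gradSq η x ^ 2 := by rwa [mul_comm (pdx2 η x)]
  refine ⟨?_, ?_, ?_, ?_⟩
  · refine integral_sq_deriv_profile_le (hasDerivAt_pdx1 hd x) (hasDerivAt_pdx1 hd1 x) (hpos x)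
      ?_ hG11
    unfold hessSq
    linarith [sq_nonneg (pdx2 (pdx1 η) x), sq_nonneg (pdx1 (pdx2 η) x),
      sq_nonneg (pdx2 (pdx2 η) x)]
  · refine integral_sq_deriv_profile_le (hasDerivAt_pdx2 hd x) (hasDerivAt_pdx2 hd1 x) (hpos x)
      ?_ hG12
    unfold hessSq
    linarith [sq_nonneg (pdx1 (pdx1 η) x), sq_nonneg (pdx1 (pdx2 η) x),
      sq_nonneg (pdx2 (pdx2 η) x)]
  · refine integral_sq_deriv_profile_le (hasDerivAt_pdx1 hd x) (hasDerivAt_pdx1 hd2 x) (hpos x)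
      ?_ hG21
    unfold hessSq
    linarith [sq_nonneg (pdx1 (pdx1 η) x), sq_nonneg (pdx2 (pdx1 η) x),
      sq_nonneg (pdx2 (pdx2 η) x)]
  · refine integral_sq_deriv_profile_le (hasDerivAt_pdx2 hd x) (hasDerivAt_pdx2 hd2 x) (hpos x)
      ?_ hG22
    unfold hessSq
    linarith [sq_nonneg (pdx1 (pdx1 η) x), sq_nonneg (pdx2 (pdx1 η) x),
      sq_nonneg (pdx1 (pdx2 η) x)]
end
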